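/- arXiv:math/9804160 — 2 statements merged into one kernel-verified Lean document; each statement's English description precedes it below -/
import Mathlib

section
/- Let m be a nonnegative integer, and let h₀, h₁ : [0,1] → ℝ be continuously differentiable with h₀(0) = 0, h₁(1) = 0, h₀(μ) > 0 for μ ∈ (0,1], h₁(μ) > 0 for μ ∈ [0,1), and (h₁/h₀)'(μ) < 0 for all μ ∈ (0,1). Let k : [0,1] → ℝ be continuous on [0,1], differentiable on (0,1), with k(μ) ∈ [m, m+1] for all μ, k(μ) not an integer for μ ∈ (0,1), and satisfying 2h₀(μ)h₁(μ)k(μ)·cos(k(μ)π) + (h₀(μ)² − h₁(μ)²k(μ)²)·sin(k(μ)π) = 0 for every μ ∈ [0,1]. Then k(0) = m, k(1) = m+1, and k is strictly monotonically increasing on [0,1]. -/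
open Real Set

/-- Half-angle factorization of the Robin characteristic function, with the phase `k π` shifted by
a multiple `m π`. -/
theorem robin_characteristic_factor (m : ℕ) (a b κ : ℝ) :
    2 * a * b * κ * cos (κ * π) + (a ^ 2 - b ^ 2 * κ ^ 2) * sin (κ * π) =
      (-1) ^ m * (2 * ((a * cos ((κ - m) * π / 2) - b * κ * sin ((κ - m) * π / 2)) *
        (a * sin ((κ - m) * π / 2) + b * κ * cos ((κ - m) * π / 2)))) := by
  set x := (κ - m) * π / 2 with hx
  have hκ : κ * π = 2 * x + m * π := by rw [hx]; ring
  rw [hκ, cos_add_nat_mul_pi, sin_add_nat_mul_pi, cos_two_mul', sin_two_mul]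
  ring

/-- A root `κ ∈ (m, m + 1)` of the Robin characteristic equation solves the reduced equation
`b κ sin ((κ - m) π / 2) = a cos ((κ - m) π / 2)`. -/
theorem robin_reduced_equation (m : ℕ) {a b κ : ℝ} (ha : 0 < a) (hb : 0 < b)
    (hκ : κ ∈ Ioo (m : ℝ) (m + 1))
    (h : 2 * a * b * κ * cos (κ * π) + (a ^ 2 - b ^ 2 * κ ^ 2) * sin (κ * π) = 0) :
    b * κ * sin ((κ - m) * π / 2) = a * cos ((κ - m) * π / 2) := by
  have hκ0 : 0 < κ := (Nat.cast_nonneg m).trans_lt hκ.1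
  have hx0 : 0 < (κ - m) * π / 2 := by
    have := mul_pos (sub_pos.2 hκ.1) pi_pos
    linarith
  have hx1 : (κ - m) * π / 2 < π / 2 := by
    have := mul_pos (sub_pos.2 hκ.2) pi_pos
    linarith
  have hs : 0 < sin ((κ - m) * π / 2) := sin_pos_of_pos_of_lt_pi hx0 (by linarith [pi_pos])
  have hc : 0 < cos ((κ - m) * π / 2) := cos_pos_of_mem_Ioo ⟨by linarith, hx1⟩
  have hne : a * sin ((κ - m) * π / 2) + b * κ * cos ((κ - m) * π / 2) ≠ 0 := by positivity
  rw [robin_characteristic_factor m] at h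
  simp only [mul_eq_zero, pow_eq_zero_iff', hne, or_false] at h
  norm_num at h
  linarith

/-- Along the homotopy of boundary conditions, the wavenumber `k(μ)` increases
monotonically from `m` at `μ = 0` to `m + 1` at `μ = 1`. -/
theorem stmt_2 (m : ℕ) (h₀ h₁ k : ℝ → ℝ)
    (hh₀ : ContDiffOn ℝ 1 h₀ (Icc 0 1)) (hh₁ : ContDiffOn ℝ 1 h₁ (Icc 0 1))
    (h00 : h₀ 0 = 0) (h11 : h₁ 1 = 0)
    (h₀pos : ∀ μ ∈ Ioc (0:ℝ) 1, 0 < h₀ μ)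
    (h₁pos : ∀ μ ∈ Ico (0:ℝ) 1, 0 < h₁ μ)
    (hratio : ∀ μ ∈ Ioo (0:ℝ) 1, ∃ d : ℝ, d < 0 ∧
      HasDerivAt (fun t => h₁ t / h₀ t) d μ)
    (hkcont : ContinuousOn k (Icc 0 1))
    (hkdiff : ∀ μ ∈ Ioo (0:ℝ) 1, DifferentiableAt ℝ k μ)
    (hkrange : ∀ μ ∈ Icc (0:ℝ) 1, k μ ∈ Icc (m : ℝ) ((m : ℝ) + 1))
    (hknotint : ∀ μ ∈ Ioo (0:ℝ) 1, ∀ j : ℤ, k μ ≠ (j : ℝ))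
    (hchar : ∀ μ ∈ Icc (0:ℝ) 1,
      2 * h₀ μ * h₁ μ * k μ * Real.cos (k μ * π) +
        (h₀ μ ^ 2 - h₁ μ ^ 2 * k μ ^ 2) * Real.sin (k μ * π) = 0) :
    k 0 = m ∧ k 1 = (m : ℝ) + 1 ∧ StrictMonoOn k (Icc 0 1) := by
  have hk : ∀ μ ∈ Ioo (0 : ℝ) 1, k μ ∈ Ioo (m : ℝ) (m + 1) := fun μ hμ => by
    obtain ⟨hl, hu⟩ := hkrange μ (Ioo_subset_Icc_self hμ)
    exact ⟨hl.lt_of_ne fun h => hknotint μ hμ m (by simp [h]),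
      hu.lt_of_ne fun h => hknotint μ hμ (m + 1) (by simp [h])⟩
  have hred : EqOn (fun μ => h₁ μ * k μ * sin ((k μ - m) * π / 2))
      (fun μ => h₀ μ * cos ((k μ - m) * π / 2)) (Icc 0 1) := by
    have h₀c := hh₀.continuousOn
    have h₁c := hh₁.continuousOn
    refine EqOn.of_subset_closure (s := Ioo 0 1) (fun μ hμ => ?_) (by fun_prop) (by fun_prop)
      Ioo_subset_Icc_self (closure_Ioo zero_ne_one).ge
    exact robin_reduced_equation m (h₀pos μ ⟨hμ.1, hμ.2.le⟩) (h₁pos μ ⟨hμ.1.le, hμ.2⟩) (hk μ hμ)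
      (hchar μ (Ioo_subset_Icc_self hμ))
  have hk0 : k 0 = m := by
    have h := hred (left_mem_Icc.2 zero_le_one)
    obtain ⟨hl, hu⟩ := hkrange 0 (left_mem_Icc.2 zero_le_one)
    have hb := h₁pos 0 (left_mem_Ico.2 zero_lt_one)
    by_contra hne
    have hlt : (m : ℝ) < k 0 := hl.lt_of_ne (Ne.symm hne)
    have hpos : 0 < k 0 := (Nat.cast_nonneg m).trans_lt hlt
    have hx : 0 < (k 0 - m) * π / 2 := by
      have := mul_pos (sub_pos.2 hlt) pi_pos
      linarith
    have hs : 0 < sin ((k 0 - m) * π / 2) :=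
      sin_pos_of_pos_of_lt_pi hx (by nlinarith [pi_pos])
    have : 0 < h₁ 0 * k 0 * sin ((k 0 - m) * π / 2) := by positivity
    simp only [h00, zero_mul] at h
    exact this.ne' h
  have hk1 : k 1 = m + 1 := by
    have h := hred (right_mem_Icc.2 zero_le_one)
    obtain ⟨hl, hu⟩ := hkrange 1 (right_mem_Icc.2 zero_le_one)
    have ha := h₀pos 1 (right_mem_Ioc.2 zero_lt_one)
    by_contra hne
    have hlt : k 1 < m + 1 := hu.lt_of_ne hne
    have hc : 0 < cos ((k 1 - m) * π / 2) :=
      cos_pos_of_mem_Ioo ⟨by nlinarith [pi_pos], by nlinarith [pi_pos]⟩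
    simp only [h11, zero_mul] at h
    exact (mul_pos ha hc).ne h
  have hanti : StrictAntiOn (fun t => h₁ t / h₀ t) (Ioo 0 1) := by
    refine strictAntiOn_of_deriv_neg (convex_Ioo 0 1) (fun μ hμ => ?_) (fun μ hμ => ?_)
    · obtain ⟨d, -, h⟩ := hratio μ hμ
      exact h.continuousAt.continuousWithinAt
    · rw [interior_Ioo] at hμ
      obtain ⟨d, hd, h⟩ := hratio μ hμ
      rwa [h.deriv]
  refine ⟨hk0, hk1, fun μ hμ ν hν hμν => ?_⟩
  rcases hμ.1.eq_or_lt with rfl | hμ0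
  · rcases hν.2.eq_or_lt with rfl | hν1
    · linarith
    · exact hk0.trans_lt (hk ν ⟨hμν, hν1⟩).1
  rcases hν.2.eq_or_lt with rfl | hν1
  · exact (hk μ ⟨hμ0, hμν⟩).2.trans_eq hk1.symm
  have hμI : μ ∈ Ioo (0 : ℝ) 1 := ⟨hμ0, hμν.trans hν1⟩
  have hνI : ν ∈ Ioo (0 : ℝ) 1 := ⟨hμ0.trans hμν, hν1⟩
  by_contra! hle
  have hreddiv : ∀ t ∈ Ioo (0 : ℝ) 1,
      h₁ t / h₀ t * (k t * sin ((k t - m) * π / 2)) = cos ((k t - m) * π / 2) := fun t ht => by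
    have ha := h₀pos t ⟨ht.1, ht.2.le⟩
    rw [div_mul_eq_mul_div, div_eq_iff ha.ne', ← mul_assoc, mul_comm (cos _)]
    exact hred (Ioo_subset_Icc_self ht)
  have hkμ := hk μ hμI
  have hkν := hk ν hνI
  have hm : (0 : ℝ) ≤ m := Nat.cast_nonneg m
  have hx0 : 0 < (k ν - m) * π / 2 := by
    have := mul_pos (sub_pos.2 hkν.1) pi_pos
    linarith
  have hxx : (k ν - m) * π / 2 ≤ (k μ - m) * π / 2 := by gcongr
  have hx1 : (k μ - m) * π / 2 < π / 2 := by
    have := mul_pos (sub_pos.2 hkμ.2) pi_pos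
    linarith
  have hcos := cos_le_cos_of_nonneg_of_le_pi hx0.le (by linarith [pi_pos]) hxx
  have hsin := sin_le_sin_of_le_of_le_pi_div_two (by linarith) hx1.le hxx
  have hsν : 0 < sin ((k ν - m) * π / 2) := sin_pos_of_pos_of_lt_pi hx0 (by linarith)
  have hkν0 : 0 < k ν := hm.trans_lt hkν.1
  have hrν : 0 < h₁ ν / h₀ ν := div_pos (h₁pos ν ⟨hνI.1.le, hνI.2⟩) (h₀pos ν ⟨hνI.1, hνI.2.le⟩)
  have hlt : h₁ ν / h₀ ν * (k ν * sin ((k ν - m) * π / 2)) <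
      h₁ μ / h₀ μ * (k μ * sin ((k μ - m) * π / 2)) :=
    mul_lt_mul (hanti hμI hνI hμν) (mul_le_mul hle hsin hsν.le (hkν0.le.trans hle))
      (mul_pos hkν0 hsν) (hrν.trans (hanti hμI hνI hμν)).le
  rw [hreddiv μ hμI, hreddiv ν hνI] at hlt
  exact hlt.not_ge hcos
end

section
/- Let n and k be distinct positive integers, set φ₁(x,y) = (2/π)·cos(nx)·cos(ky) and φ₂(x,y) = (2/π)·cos(kx)·cos(ny), and let z₁, z₂ be real numbers. Then ∫₀^π ∫₀^π φ₁(x,y)·(2y/π − 1)·∂/∂y[z₁φ₁(x,y) + z₂φ₂(x,y)] dx dy = z₁/π, and ∫₀^π ∫₀^π φ₂(x,y)·(2y/π − 1)·∂/∂y[z₁φ₁(x,y) + z₂φ₂(x,y)] dx dy = z₂/π. (These identities yield the symmetry-breaking coefficients d₁ = d₂ = (4/π)·(h₀/h₁)'(0) in the reduced bifurcation equations when n·k ≠ 0.) -/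
open Real

lemma integral_cos_nat_mul_sq (n : ℕ) (hn : 0 < n) :
    ∫ x in (0:ℝ)..π, cos (n * x) ^ 2 = π / 2 := by
  have hn' : (n : ℝ) ≠ 0 := by positivity
  have hderiv : ∀ x ∈ Set.uIcc (0:ℝ) π,
      HasDerivAt (fun x : ℝ => x / 2 + sin (n * x) * cos (n * x) / (2 * n))
        (cos (n * x) ^ 2) x := by
    intro x _
    have h := (hasDerivAt_id' x).const_mul (n : ℝ)
    refine (((hasDerivAt_id' x).div_const 2).add
      ((h.sin.mul h.cos).div_const (2 * (n : ℝ)))).congr_deriv ?_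
    field_simp
    linear_combination (-1) * (sin_sq_add_cos_sq (n * x))
  rw [intervalIntegral.integral_eq_sub_of_hasDerivAt hderiv
    ((by fun_prop : Continuous _).intervalIntegrable _ _)]
  simp [sin_nat_mul_pi]

lemma integral_cos_nat_mul_mul_cos_nat_mul (n k : ℕ) (hnk : n ≠ k) :
    ∫ x in (0:ℝ)..π, cos (n * x) * cos (k * x) = 0 := by
  have hne : (k : ℝ) ^ 2 - (n : ℝ) ^ 2 ≠ 0 := by
    rw [sub_ne_zero, Ne, pow_left_inj₀ (by positivity) (by positivity) two_ne_zero]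
    exact_mod_cast hnk.symm
  have hderiv : ∀ x ∈ Set.uIcc (0:ℝ) π,
      HasDerivAt (fun x : ℝ => (k * (cos (n * x) * sin (k * x)) - n * (sin (n * x) * cos (k * x)))
        / ((k : ℝ) ^ 2 - (n : ℝ) ^ 2)) (cos (n * x) * cos (k * x)) x := by
    intro x _
    have h := (hasDerivAt_id' x).const_mul (n : ℝ)
    have h' := (hasDerivAt_id' x).const_mul (k : ℝ)
    refine ((((h.cos.mul h'.sin).const_mul (k : ℝ)).sub
      ((h.sin.mul h'.cos).const_mul (n : ℝ))).div_const
        ((k : ℝ) ^ 2 - (n : ℝ) ^ 2)).congr_deriv ?_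
    rw [div_eq_iff hne]
    ring
  rw [intervalIntegral.integral_eq_sub_of_hasDerivAt hderiv
    ((by fun_prop : Continuous _).intervalIntegrable _ _)]
  simp [sin_nat_mul_pi]

lemma integral_cos_nat_mul_mul_deriv (k : ℕ) (hk : 0 < k) :
    ∫ y in (0:ℝ)..π, cos (k * y) * ((2 * y / π - 1) * (-sin (k * y) * k)) = 1 / 2 := by
  have hk' : (k : ℝ) ≠ 0 := by positivity
  have hderiv : ∀ y ∈ Set.uIcc (0:ℝ) π,
      HasDerivAt (fun y : ℝ => (2 * y / π - 1) * cos (k * y) ^ 2 / 2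
          - (y / 2 + sin (k * y) * cos (k * y) / (2 * k)) / π)
        (cos (k * y) * ((2 * y / π - 1) * (-sin (k * y) * k))) y := by
    intro y _
    have h := (hasDerivAt_id' y).const_mul (k : ℝ)
    have hw := (((hasDerivAt_id' y).const_mul 2).div_const π).sub_const 1
    refine (((hw.mul (h.cos.pow 2)).div_const 2).sub
      ((((hasDerivAt_id' y).div_const 2).add
        ((h.sin.mul h.cos).div_const (2 * (k : ℝ)))).div_const π)).congr_deriv ?_
    simp only [Pi.pow_apply]
    field_simp
    push_cast
    linear_combination (sin_sq_add_cos_sq (k * y))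
  rw [intervalIntegral.integral_eq_sub_of_hasDerivAt hderiv
    ((by fun_prop : Continuous _).intervalIntegrable _ _)]
  have hcos : cos (k * π) ^ 2 = 1 := by
    have := sin_sq_add_cos_sq (k * π)
    simpa [sin_nat_mul_pi] using this
  simp only [hcos, sin_nat_mul_pi]
  simp
  field_simp
  norm_num

lemma integral_cos_mul_cos_mul_deriv (n k : ℕ) (hn : 0 < n) (hk : 0 < k) (hnk : n ≠ k)
    (z₁ z₂ : ℝ) :
    ∫ x in (0:ℝ)..π, ∫ y in (0:ℝ)..π,
      (2 / π) * cos (n * x) * cos (k * y) * ((2 * y / π - 1) *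
        deriv (fun t => z₁ * ((2 / π) * cos (n * x) * cos (k * t))
          + z₂ * ((2 / π) * cos (k * x) * cos (n * t))) y) = z₁ / π := by
  have hderiv : ∀ x y : ℝ, deriv (fun t => z₁ * ((2 / π) * cos (n * x) * cos (k * t))
          + z₂ * ((2 / π) * cos (k * x) * cos (n * t))) y =
      z₁ * ((2 / π) * cos (n * x) * (-sin (k * y) * k))
        + z₂ * ((2 / π) * cos (k * x) * (-sin (n * y) * n)) := by
    intro x y
    have h := ((hasDerivAt_id' y).const_mul (n : ℝ)).cos
    have h' := ((hasDerivAt_id' y).const_mul (k : ℝ)).cos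
    refine (((h'.const_mul ((2 / π) * cos (n * x))).const_mul z₁).add
      ((h.const_mul ((2 / π) * cos (k * x))).const_mul z₂)).deriv.trans ?_
    simp only [mul_one]
  set B := ∫ y in (0:ℝ)..π, cos (k * y) * ((2 * y / π - 1) * (-sin (n * y) * n))
  have hinner : ∀ x : ℝ, ∫ y in (0:ℝ)..π,
      (2 / π) * cos (n * x) * cos (k * y) * ((2 * y / π - 1) *
        deriv (fun t => z₁ * ((2 / π) * cos (n * x) * cos (k * t))
          + z₂ * ((2 / π) * cos (k * x) * cos (n * t))) y) =
      (z₁ * (2 / π) ^ 2 * (1 / 2)) * cos (n * x) ^ 2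
        + (z₂ * (2 / π) ^ 2 * B) * (cos (n * x) * cos (k * x)) := by
    intro x
    calc
      _ = ∫ y in (0:ℝ)..π,
          (z₁ * (2 / π) ^ 2 * cos (n * x) ^ 2) *
            (cos (k * y) * ((2 * y / π - 1) * (-sin (k * y) * k)))
          + (z₂ * (2 / π) ^ 2 * (cos (n * x) * cos (k * x))) *
            (cos (k * y) * ((2 * y / π - 1) * (-sin (n * y) * n))) := by
        congr 1 with y
        rw [hderiv]
        ring
      _ = _ := by
        rw [intervalIntegral.integral_add
          ((by fun_prop : Continuous _).intervalIntegrable _ _)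
          ((by fun_prop : Continuous _).intervalIntegrable _ _),
          intervalIntegral.integral_const_mul, intervalIntegral.integral_const_mul,
          integral_cos_nat_mul_mul_deriv k hk]
        ring
  simp only [hinner]
  rw [intervalIntegral.integral_add
    ((by fun_prop : Continuous _).intervalIntegrable _ _)
    ((by fun_prop : Continuous _).intervalIntegrable _ _),
    intervalIntegral.integral_const_mul, intervalIntegral.integral_const_mul,
    integral_cos_nat_mul_sq n hn, integral_cos_nat_mul_mul_cos_nat_mul n k hnk]
  field_simp
  ring

/-- The integrals yielding the symmetry-breaking coefficients `d₁ = d₂` in the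
reduced bifurcation equations when `n·k ≠ 0`. -/
theorem stmt_14 (n k : ℕ) (hn : 0 < n) (hk : 0 < k) (hnk : n ≠ k) (z₁ z₂ : ℝ)
    (φ₁ φ₂ : ℝ → ℝ → ℝ)
    (hφ₁ : φ₁ = fun x y => (2 / π) * Real.cos ((n : ℝ) * x) * Real.cos ((k : ℝ) * y))
    (hφ₂ : φ₂ = fun x y => (2 / π) * Real.cos ((k : ℝ) * x) * Real.cos ((n : ℝ) * y)) :
    (∫ x in (0:ℝ)..π, ∫ y in (0:ℝ)..π,
      φ₁ x y * ((2 * y / π - 1) *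
        deriv (fun t => z₁ * φ₁ x t + z₂ * φ₂ x t) y) = z₁ / π) ∧
    (∫ x in (0:ℝ)..π, ∫ y in (0:ℝ)..π,
      φ₂ x y * ((2 * y / π - 1) *
        deriv (fun t => z₁ * φ₁ x t + z₂ * φ₂ x t) y) = z₂ / π) := by
  subst hφ₁ hφ₂
  refine ⟨integral_cos_mul_cos_mul_deriv n k hn hk hnk z₁ z₂, ?_⟩
  simpa only [add_comm] using integral_cos_mul_cos_mul_deriv k n hk hn hnk.symm z₂ z₁
end
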